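/- There is no weighted finite automaton over the alphabet {a,b} recognizing the weighted language L_a; that is, there do not exist n ∈ ℕ, a vector α ∈ ℝⁿ, matrices M_a, M_b ∈ ℝ^{n×n}, and a vector η ∈ ℝⁿ such that L_a(c₁⋯c_k) = αᵀ M_{c₁} ⋯ M_{c_k} η for every word c₁⋯c_k ∈ {a,b}*. -/

import Mathlib

open Matrix

/-- The two-letter alphabet `{a, b}`. -/
inductive AB : Type
  | a : AB
  | b : AB
deriving DecidableEq

/-- `maxRunAux u cur m` computes the maximum of `m` and of the lengths of all blocks of
consecutive `a`'s in `u`, where the word is preceded by a run of `cur` letters `a`. -/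
def maxRunAux : List AB → ℕ → ℕ → ℕ
  | [], cur, m => max cur m
  | AB.a :: u, cur, m => maxRunAux u (cur + 1) m
  | AB.b :: u, cur, m => maxRunAux u 0 (max cur m)

/-- The length of the longest block of consecutive `a`'s in a word. -/
def maxRun (u : List AB) : ℕ := maxRunAux u 0 0

/-- The weighted language `L_a(u) = 2^(−maxRun u)`. -/
noncomputable def La (u : List AB) : ℝ := (2 : ℝ) ^ (-(maxRun u : ℤ))

theorem maxRunAux_replicate_append (i : ℕ) (u : List AB) (cur m : ℕ) :
    maxRunAux (List.replicate i AB.a ++ u) cur m = maxRunAux u (cur + i) m := by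
  induction i generalizing cur with
  | zero => simp
  | succ k ih =>
    rw [List.replicate_succ, List.cons_append, maxRunAux, ih]
    congr 1
    omega

theorem maxRun_replicate_b_replicate (i j : ℕ) :
    maxRun (List.replicate i AB.a ++ AB.b :: List.replicate j AB.a) = max i j := by
  rw [maxRun, maxRunAux_replicate_append, maxRunAux,
    ← List.append_nil (List.replicate j AB.a), maxRunAux_replicate_append, maxRunAux]
  omega

/-- The mixed second difference of `(i, j) ↦ 2^(−max i j)` is diagonal. -/
theorem second_difference_two_zpow_neg_max (i j : ℕ) :
    ((2 : ℝ) ^ (-((max i j : ℕ) : ℤ)) - 2 ^ (-((max i (j + 1) : ℕ) : ℤ))) -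
      (2 ^ (-((max (i + 1) j : ℕ) : ℤ)) - 2 ^ (-((max (i + 1) (j + 1) : ℕ) : ℤ))) =
      if i = j then (2 : ℝ) ^ (-((j + 1 : ℕ) : ℤ)) else 0 := by
  rcases lt_trichotomy i j with h | rfl | h
  · rw [if_neg h.ne, max_eq_right h.le, max_eq_right (by omega : i ≤ j + 1),
      max_eq_right (by omega : i + 1 ≤ j), max_eq_right (by omega : i + 1 ≤ j + 1)]
    ring
  · rw [if_pos rfl, max_self, max_self, max_eq_right (Nat.le_succ i), max_eq_left (Nat.le_succ i)]
    have h : (2 : ℝ) ^ (-(i : ℤ)) = 2 * 2 ^ (-((i + 1 : ℕ) : ℤ)) := by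
      rw [← zpow_one_add₀ two_ne_zero]
      congr 1
      push_cast
      ring
    rw [h]
    ring
  · rw [if_neg h.ne', max_eq_left h.le, max_eq_left (by omega : j + 1 ≤ i),
      max_eq_left (by omega : j ≤ i + 1), max_eq_left (by omega : j + 1 ≤ i + 1)]
    ring

/-- A family for which there are functionals pairing with it diagonally, with nonzero diagonal entries,
is linearly independent. -/
theorem linearIndependent_of_diagonal_pairing {ι K V : Type*} [DecidableEq ι] [Field K]
    [AddCommGroup V] [Module K V] (w : ι → V) (f : ι → V →ₗ[K] K) (d : ι → K)
    (hd : ∀ i, d i ≠ 0) (h : ∀ i j, f i (w j) = if i = j then d j else 0) :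
    LinearIndependent K w := by
  rw [linearIndependent_iff']
  intro s g hg i hi
  have := congrArg (f i) hg
  simpa [h, hi, hd] using this

/-- No weighted finite automaton over `{a, b}` recognizes the language `L_a`. -/
theorem stmt4 :
    ¬ ∃ (n : ℕ) (α η : Fin n → ℝ) (M : AB → Matrix (Fin n) (Fin n) ℝ),
      ∀ u : List AB, La u = α ⬝ᵥ ((u.map M).prod).mulVec η := by
  rintro ⟨n, α, η, M, h⟩
  let v : ℕ → Fin n → ℝ := fun j => (M AB.b * M AB.a ^ j) *ᵥ η
  let φ : ℕ → (Fin n → ℝ) →ₗ[ℝ] ℝ := fun i =>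
    (dotProductBilin ℝ ℝ α) ∘ₗ (M AB.a ^ i).mulVecLin
  have hφ : ∀ i j, φ i (v j) = (2 : ℝ) ^ (-((max i j : ℕ) : ℤ)) := by
    intro i j
    have := h (List.replicate i AB.a ++ AB.b :: List.replicate j AB.a)
    rw [La, maxRun_replicate_b_replicate] at this
    rw [this]
    simp [φ, v, Matrix.mulVec_mulVec]
  have hli : LinearIndependent ℝ fun j => v j - v (j + 1) := by
    refine linearIndependent_of_diagonal_pairing _ (fun i => φ i - φ (i + 1))
      (fun j => (2 : ℝ) ^ (-((j + 1 : ℕ) : ℤ))) (fun i => by positivity) fun i j => ?_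
    rw [LinearMap.sub_apply, map_sub, map_sub, hφ, hφ, hφ, hφ]
    exact second_difference_two_zpow_neg_max i j
  have : Finite ℕ := hli.finite_of_isNoetherian
  exact not_finite ℕ
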